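/- For every integer l ≥ 1 and all reals M₀, M₁, …, M_l ≥ 0 and K ≥ 0, there exist N > 0 and T₀ > 0 such that the following holds: for every (l+1)-times continuously differentiable f : ℝ → ℝ with |f^{(i)}(s)| ≤ K for all 1 ≤ i ≤ l+1 and all s ∈ [-M₀, M₀], every T ∈ (0, T₀], and every (l+1)-times continuously differentiable u on [0,T] × ℝ that satisfies ∂_t u + f'(u) ∂_x u = 0, whose spatial partial derivatives ∂_x^i u for 0 ≤ i ≤ l are bounded on [0,T] × ℝ, and which satisfies |∂_x^i u(0,x)| ≤ M_i for all x ∈ ℝ and 0 ≤ i ≤ l, one has |∂_x^l u(t,x)| ≤ N for all (t,x) ∈ [0,T] × ℝ. -/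

import Mathlib

open Set

noncomputable def VV (u : ℝ → ℝ → ℝ) (i : ℕ) (p : ℝ × ℝ) : ℝ :=
  iteratedDeriv i (fun y => u p.1 y) p.2

lemma strip_uniq {T : ℝ} (hT : 0 < T) :
    UniqueDiffOn ℝ (Icc (0:ℝ) T ×ˢ (univ : Set ℝ)) :=
  (uniqueDiffOn_Icc hT).prod uniqueDiffOn_univ

lemma VV_slice {T : ℝ} {u : ℝ → ℝ → ℝ} {i : ℕ}
    (h : DifferentiableOn ℝ (VV u i) (Icc (0:ℝ) T ×ˢ (univ : Set ℝ)))
    {p : ℝ × ℝ} (hp : p ∈ Icc (0:ℝ) T ×ˢ (univ : Set ℝ)) :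
    HasDerivAt (fun y => VV u i (p.1, y))
      (fderivWithin ℝ (VV u i) (Icc (0:ℝ) T ×ˢ (univ : Set ℝ)) p (0, 1)) p.2 := by
  have h1 := (h p hp).hasFDerivWithinAt
  have h2 : HasDerivWithinAt (fun y : ℝ => (p.1, y)) ((0:ℝ), (1:ℝ)) univ p.2 :=
    ((hasDerivAt_const p.2 p.1).prodMk (hasDerivAt_id p.2)).hasDerivWithinAt
  have h3 := HasFDerivWithinAt.comp_hasDerivWithinAt (x := p.2) (f := fun y : ℝ => (p.1, y))
    (s := univ) (t := Icc (0:ℝ) T ×ˢ (univ : Set ℝ)) (l := VV u i) (hl := h1) h2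
    (fun y _ => ⟨hp.1, mem_univ _⟩)
  exact hasDerivWithinAt_univ.1 h3

lemma VV_succ {T : ℝ} {u : ℝ → ℝ → ℝ} {i : ℕ}
    (h : DifferentiableOn ℝ (VV u i) (Icc (0:ℝ) T ×ˢ (univ : Set ℝ)))
    {p : ℝ × ℝ} (hp : p ∈ Icc (0:ℝ) T ×ˢ (univ : Set ℝ)) :
    VV u (i + 1) p = fderivWithin ℝ (VV u i) (Icc (0:ℝ) T ×ˢ (univ : Set ℝ)) p (0, 1) := by
  rw [← (VV_slice h hp).deriv]
  simp only [VV, iteratedDeriv_succ]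

lemma VV_contDiffOn {T : ℝ} (hT : 0 < T) {u : ℝ → ℝ → ℝ} {n : ℕ}
    (hu : ContDiffOn ℝ n (fun p : ℝ × ℝ => u p.1 p.2) (Icc 0 T ×ˢ univ)) (i : ℕ) :
    ∀ m : ℕ, i + m ≤ n → ContDiffOn ℝ m (VV u i) (Icc (0:ℝ) T ×ˢ (univ : Set ℝ)) := by
  induction i with
  | zero =>
    intro m hm
    have : VV u 0 = fun p : ℝ × ℝ => u p.1 p.2 := by
      ext p; simp [VV]
    rw [this]
    exact hu.of_le (by exact_mod_cast (by omega : m ≤ n))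
  | succ i ih =>
    intro m hm
    have h1 := ih (m + 1) (by omega)
    have hd : DifferentiableOn ℝ (VV u i) (Icc (0:ℝ) T ×ˢ (univ : Set ℝ)) :=
      h1.differentiableOn (by simp)
    have h2 : ContDiffOn ℝ m (fderivWithin ℝ (VV u i) (Icc (0:ℝ) T ×ˢ (univ : Set ℝ)))
        (Icc (0:ℝ) T ×ˢ (univ : Set ℝ)) :=
      h1.fderivWithin (strip_uniq hT) (by push_cast; exact le_rfl)
    exact (h2.clm_apply contDiffOn_const).congr (fun p hp => VV_succ hd hp)

lemma slice_contDiff {T : ℝ} {u : ℝ → ℝ → ℝ} {n : ℕ}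
    (hu : ContDiffOn ℝ n (fun p : ℝ × ℝ => u p.1 p.2) (Icc 0 T ×ˢ univ)) {s : ℝ}
    (hs : s ∈ Icc (0:ℝ) T) : ContDiff ℝ n (fun y => u s y) := by
  rw [← contDiffOn_univ]
  exact ContDiffOn.comp (f := fun y : ℝ => (s, y)) hu (by fun_prop)
    (fun y _ => ⟨hs, mem_univ _⟩)

lemma strip_nhds {T s x : ℝ} (hs : s ∈ Ioo (0:ℝ) T) :
    Icc (0:ℝ) T ×ˢ (univ : Set ℝ) ∈ nhds (s, x) :=
  prod_mem_nhds (Icc_mem_nhds hs.1 hs.2) Filter.univ_mem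

lemma VV_succ' {T : ℝ} {u : ℝ → ℝ → ℝ} {i : ℕ}
    (h : DifferentiableOn ℝ (VV u i) (Icc (0:ℝ) T ×ˢ (univ : Set ℝ)))
    {s x : ℝ} (hs : s ∈ Ioo (0:ℝ) T) :
    VV u (i + 1) (s, x) = fderiv ℝ (VV u i) (s, x) (0, 1) := by
  rw [VV_succ h ⟨Ioo_subset_Icc_self hs, mem_univ _⟩, fderivWithin_of_mem_nhds (strip_nhds hs)]

/-- time derivative of the `i`th spatial derivative -/
lemma VV_time {T : ℝ} (hT : 0 < T) {u : ℝ → ℝ → ℝ} {l : ℕ} {F : ℝ → ℝ → ℝ}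
    (hu : ContDiffOn ℝ (l + 1 : ℕ) (fun p : ℝ × ℝ => u p.1 p.2) (Icc 0 T ×ˢ univ))
    (hF : ∀ s ∈ Icc (0:ℝ) T, ∀ x, deriv (fun r => u r x) s = F s x) (i : ℕ) :
    i ≤ l → ∀ s ∈ Ioo (0:ℝ) T, ∀ x,
      fderiv ℝ (VV u i) (s, x) (1, 0) = iteratedDeriv i (F s) x := by
  induction i with
  | zero =>
    intro _ s hs x
    have h1 := VV_contDiffOn hT hu 0 1 (by omega)
    have hd : DifferentiableAt ℝ (VV u 0) (s, x) :=
      (h1.contDiffAt (strip_nhds hs)).differentiableAt (by simp)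
    have h2 : HasDerivAt (fun r : ℝ => (r, x)) ((1:ℝ), (0:ℝ)) s :=
      (hasDerivAt_id s).prodMk (hasDerivAt_const s x)
    have h3 := HasFDerivAt.comp_hasDerivAt (f := fun r : ℝ => (r, x)) s hd.hasFDerivAt h2
    rw [iteratedDeriv_zero, ← hF s (Ioo_subset_Icc_self hs) x, ← h3.deriv]
    congr 1
  | succ i ih =>
    intro hi s hs x
    have h1 := VV_contDiffOn hT hu i 2 (by omega)
    have hc : ContDiffAt ℝ 2 (VV u i) (s, x) := h1.contDiffAt (strip_nhds hs)
    have hd : DifferentiableOn ℝ (VV u i) (Icc (0:ℝ) T ×ˢ (univ : Set ℝ)) :=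
      h1.differentiableOn (by simp)
    have hdd : DifferentiableAt ℝ (fderiv ℝ (VV u i)) (s, x) :=
      (hc.fderiv_right (m := 1) (by norm_num)).differentiableAt (by simp)
    have hsym := hc.isSymmSndFDerivAt (by simp)
    have hev : VV u (i + 1) =ᶠ[nhds (s, x)] fun q => fderiv ℝ (VV u i) q (0, 1) := by
      filter_upwards [prod_mem_nhds (Ioo_mem_nhds hs.1 hs.2) Filter.univ_mem] with q hq
      exact VV_succ' hd hq.1
    rw [hev.fderiv_eq]
    have e1 : fderiv ℝ (fun q => fderiv ℝ (VV u i) q (0, 1)) (s, x) (1, 0)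
        = fderiv ℝ (fderiv ℝ (VV u i)) (s, x) (1, 0) (0, 1) := by
      rw [fderiv_clm_apply hdd (differentiableAt_const _)]
      simp
    rw [e1, hsym, iteratedDeriv_succ]
    have h2 : HasDerivAt (fun y : ℝ => (s, y)) ((0:ℝ), (1:ℝ)) x :=
      (hasDerivAt_const x s).prodMk (hasDerivAt_id x)
    have h3 := HasFDerivAt.comp_hasDerivAt (f := fun y : ℝ => (s, y)) x hdd.hasFDerivAt h2
    have h4 := h3.clm_apply (hasDerivAt_const x ((1:ℝ), (0:ℝ)))
    simp only [Function.comp_def, map_zero, add_zero] at h4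
    rw [← h4.deriv]
    congr 1
    ext y
    exact ih (by omega) s hs y

lemma E_bound {l : ℕ} {g v : ℝ → ℝ} {K R x c : ℝ} (hR : 1 ≤ R) (hK : 0 ≤ K)
    (hg : ContDiff ℝ l g) (hv : ContDiff ℝ (l + 1 : ℕ) v) (hc : g (v x) = c)
    (hgK : ∀ i ≤ l, |iteratedDeriv i g (v x)| ≤ K) {i : ℕ} (hi : i ≤ l)
    (hvR : ∀ j ≤ l, |iteratedDeriv j v x| ≤ R) :
    |iteratedDeriv i (fun y => (g (v y) - c) * deriv v y) x|
      ≤ 2 ^ l * (l.factorial * K * R ^ l * R) := by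
  have hv' : ContDiff ℝ l v := hv.of_le (by exact_mod_cast Nat.le_succ l)
  have hdv : ContDiff ℝ l (deriv v) := by
    have := hv
    push_cast at this
    exact (contDiff_succ_iff_deriv.1 this).2.2
  have hgv : ContDiff ℝ l (g ∘ v) := hg.comp hv'
  have hA : ContDiff ℝ l (fun y => g (v y) - c) := hgv.sub contDiff_const
  have h := norm_iteratedFDeriv_mul_le hA hdv x (n := i) (by exact_mod_cast hi)
  simp only [norm_iteratedFDeriv_eq_norm_iteratedDeriv, Real.norm_eq_abs] at h
  refine h.trans ?_
  have hQ : 0 ≤ (l.factorial : ℝ) * K * R ^ l * R := by positivity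
  calc _ ≤ ∑ j ∈ Finset.range (i + 1), (i.choose j : ℝ) * (l.factorial * K * R ^ l * R) := by
        apply Finset.sum_le_sum
        intro j hj
        have hj' : j ≤ i := by simpa [Nat.lt_succ_iff] using hj
        rw [mul_assoc]
        refine mul_le_mul_of_nonneg_left ?_ (by positivity)
        rcases Nat.eq_zero_or_pos j with rfl | hj0
        · simp only [iteratedDeriv_zero, hc]
          simpa using hQ
        · have e1 : iteratedDeriv j (fun y => g (v y) - c) x = iteratedDeriv j (g ∘ v) x := by
            have := iteratedDeriv_const_add (f := g ∘ v) (x := x) hj0 (-c)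
            rw [← this]
            congr 1
            ext y
            simp; ring
          have b1 : |iteratedDeriv j (g ∘ v) x| ≤ j.factorial * K * R ^ j := by
            have := norm_iteratedFDeriv_comp_le hg hv' (n := j) (by exact_mod_cast hj'.trans hi) x
              (C := K) (D := R)
              (fun k hk => by
                rw [norm_iteratedFDeriv_eq_norm_iteratedDeriv]
                exact hgK k (by omega))
              (fun k hk1 hk => by
                rw [norm_iteratedFDeriv_eq_norm_iteratedDeriv]
                exact (hvR k (by omega)).trans (le_self_pow₀ hR (by omega)))
            rwa [norm_iteratedFDeriv_eq_norm_iteratedDeriv] at this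
          have b2 : |iteratedDeriv (i - j) (deriv v) x| ≤ R := by
            rw [← iteratedDeriv_succ']
            exact hvR _ (by omega)
          rw [e1]
          refine mul_le_mul (b1.trans ?_) b2 (abs_nonneg _) (by positivity)
          have : j.factorial ≤ l.factorial := Nat.factorial_le (by omega)
          have h3 : R ^ j ≤ R ^ l := pow_le_pow_right₀ hR (by omega)
          gcongr
    _ = 2 ^ i * (l.factorial * K * R ^ l * R) := by
        rw [← Finset.sum_mul]
        congr 1
        exact_mod_cast Nat.sum_range_choose i
    _ ≤ _ := by
        gcongr
        norm_num

/-- A function with `|g'| ≤ L |g - U|` that takes the value `U` somewhere is constant. -/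
lemma const_of_deriv_bound {T L U t₀ : ℝ} {g g' : ℝ → ℝ} (hg : ContinuousOn g (Icc 0 T))
    (hg' : ∀ s ∈ Ioo (0:ℝ) T, HasDerivAt g (g' s) s)
    (hb : ∀ s ∈ Ioo (0:ℝ) T, |g' s| ≤ L * |g s - U|) (ht : t₀ ∈ Icc (0:ℝ) T)
    (h0 : g t₀ = U) : ∀ s ∈ Icc (0:ℝ) T, g s = U := by
  have key : ∀ s ∈ Ioo (0:ℝ) T, |(g s - U) * g' s| ≤ L * (g s - U) ^ 2 := by
    intro s hs
    rw [abs_mul, ← sq_abs (g s - U)]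
    nlinarith [hb s hs, abs_nonneg (g s - U)]
  have hder : ∀ a : ℝ, ∀ s ∈ Ioo (0:ℝ) T,
      HasDerivAt (fun s => (g s - U) ^ 2 * Real.exp (a * s))
        ((2 * ((g s - U) * g' s) + a * (g s - U) ^ 2) * Real.exp (a * s)) s := by
    intro a s hs
    have h1 := ((hg' s hs).sub_const U).pow 2
    have h2 : HasDerivAt (fun s => Real.exp (a * s)) (Real.exp (a * s) * (a * 1)) s :=
      ((hasDerivAt_id s).const_mul a).exp
    refine (h1.mul h2).congr_deriv ?_
    simp
    ring
  have hcont : ∀ a : ℝ, ContinuousOn (fun s => (g s - U) ^ 2 * Real.exp (a * s)) (Icc 0 T) := by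
    intro a
    have : ContinuousOn (fun s => Real.exp (a * s)) (Icc 0 T) := by fun_prop
    exact ((hg.sub continuousOn_const).pow 2).mul this
  have hmono : MonotoneOn (fun s => (g s - U) ^ 2 * Real.exp ((2 * L) * s)) (Icc 0 T) := by
    apply monotoneOn_of_deriv_nonneg (convex_Icc 0 T) (hcont _)
    · rw [interior_Icc]
      exact fun s hs => (hder _ s hs).differentiableAt.differentiableWithinAt
    · rw [interior_Icc]
      intro s hs
      rw [(hder _ s hs).deriv]
      have := abs_le.1 (key s hs)
      exact mul_nonneg (by linarith [this.1]) (Real.exp_pos _).le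
  have hanti : AntitoneOn (fun s => (g s - U) ^ 2 * Real.exp ((-(2 * L)) * s)) (Icc 0 T) := by
    apply antitoneOn_of_deriv_nonpos (convex_Icc 0 T) (hcont _)
    · rw [interior_Icc]
      exact fun s hs => (hder _ s hs).differentiableAt.differentiableWithinAt
    · rw [interior_Icc]
      intro s hs
      rw [(hder _ s hs).deriv]
      have := abs_le.1 (key s hs)
      exact mul_nonpos_of_nonpos_of_nonneg (by linarith [this.2]) (Real.exp_pos _).le
  intro s hs
  have fin : ∀ e : ℝ, 0 < e → (g s - U) ^ 2 * e ≤ 0 → g s = U := by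
    intro e he h
    have h1 : (g s - U) ^ 2 ≤ 0 := by
      by_contra hcon
      push Not at hcon
      nlinarith [mul_pos hcon he]
    have h2 : g s - U = 0 := by
      apply pow_eq_zero_iff (two_ne_zero) |>.1
      exact le_antisymm h1 (sq_nonneg _)
    linarith
  rcases le_total s t₀ with h | h
  · have := hmono hs ht h
    simp only [h0, sub_self] at this
    exact fin _ (Real.exp_pos _) (this.trans_eq (by simp))
  · have := hanti ht hs h
    simp only [h0, sub_self] at this
    exact fin _ (Real.exp_pos _) (this.trans_eq (by simp))

lemma VV_line {T : ℝ} {u : ℝ → ℝ → ℝ} {i : ℕ}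
    (h : ContDiffOn ℝ 1 (VV u i) (Icc (0:ℝ) T ×ˢ (univ : Set ℝ)))
    (x₀ t₀ c : ℝ) :
    ContinuousOn (fun s => VV u i (s, x₀ + c * (s - t₀))) (Icc 0 T) ∧
    ∀ s ∈ Ioo (0:ℝ) T, HasDerivAt (fun s => VV u i (s, x₀ + c * (s - t₀)))
      (fderiv ℝ (VV u i) (s, x₀ + c * (s - t₀)) (1, 0) + c * VV u (i + 1) (s, x₀ + c * (s - t₀)))
      s := by
  constructor
  · exact h.continuousOn.comp (f := fun s : ℝ => (s, x₀ + c * (s - t₀))) (by fun_prop)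
      (fun s hs => ⟨hs, mem_univ _⟩)
  · intro s hs
    have hd : DifferentiableOn ℝ (VV u i) (Icc (0:ℝ) T ×ˢ (univ : Set ℝ)) :=
      h.differentiableOn (by simp)
    have hda : DifferentiableAt ℝ (VV u i) (s, x₀ + c * (s - t₀)) :=
      hd.differentiableAt (strip_nhds hs)
    rw [VV_succ' hd hs]
    have h1 : HasDerivAt (fun s : ℝ => x₀ + c * (s - t₀)) (c * 1) s :=
      (((hasDerivAt_id s).sub_const t₀).const_mul c).const_add x₀
    have h2 : HasDerivAt (fun s : ℝ => (s, x₀ + c * (s - t₀))) ((1:ℝ), c * 1) s :=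
      (hasDerivAt_id s).prodMk h1
    have h3 := HasFDerivAt.comp_hasDerivAt (f := fun s : ℝ => (s, x₀ + c * (s - t₀))) s
      hda.hasFDerivAt h2
    refine h3.congr_deriv ?_
    have : ((1:ℝ), c * 1) = (1, 0) + c • ((0:ℝ), (1:ℝ)) := by simp
    rw [this, map_add, map_smul, smul_eq_mul]



/-- Short-time boundedness of the `l`-th spatial derivative of a smooth solution of a
scalar conservation law, with bound computable from bounds on the initial derivatives
up to order `l` and on the derivatives of the flux. -/
theorem short_time_derivative_bound
    (l : ℕ) (hl : 1 ≤ l) (M : ℕ → ℝ) (hM : ∀ i ≤ l, 0 ≤ M i)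
    (K : ℝ) (hK : 0 ≤ K) :
    ∃ N : ℝ, 0 < N ∧ ∃ T₀ : ℝ, 0 < T₀ ∧
      ∀ f : ℝ → ℝ, ContDiff ℝ (l + 1 : ℕ) f →
        (∀ i : ℕ, 1 ≤ i → i ≤ l + 1 →
          ∀ s ∈ Icc (-(M 0)) (M 0), |iteratedDeriv i f s| ≤ K) →
      ∀ T : ℝ, 0 < T → T ≤ T₀ →
      ∀ u : ℝ → ℝ → ℝ,
        ContDiffOn ℝ (l + 1 : ℕ) (fun p : ℝ × ℝ => u p.1 p.2) (Icc 0 T ×ˢ univ) →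
        (∀ t ∈ Icc (0:ℝ) T, ∀ x : ℝ,
          deriv (fun s => u s x) t
            + deriv f (u t x) * deriv (fun y => u t y) x = 0) →
        (∀ i ≤ l, ∃ C : ℝ, ∀ t ∈ Icc (0:ℝ) T, ∀ x : ℝ,
          |iteratedDeriv i (fun y => u t y) x| ≤ C) →
        (∀ i ≤ l, ∀ x : ℝ, |iteratedDeriv i (fun y => u 0 y) x| ≤ M i) →
        ∀ t ∈ Icc (0:ℝ) T, ∀ x : ℝ, |iteratedDeriv l (fun y => u t y) x| ≤ N := by
  classical
  set S : ℝ := ∑ i ∈ Finset.range (l + 1), M i with hS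
  have hMS : ∀ i ≤ l, M i ≤ S := fun i hi =>
    Finset.single_le_sum (f := M) (fun j hj => hM j (by simpa [Nat.lt_succ_iff] using hj))
      (by simpa [Nat.lt_succ_iff] using hi)
  have hS0 : 0 ≤ S := (hM 0 (by omega)).trans (hMS 0 (by omega))
  set R : ℝ := S + 1 with hR
  have hR1 : 1 ≤ R := by linarith
  set B : ℝ := 2 ^ l * (l.factorial * K * R ^ l * R) with hB
  have hB0 : 0 ≤ B := by positivity
  refine ⟨R, by linarith, 1 / (2 * (B + 1)), by positivity, ?_⟩
  intro f hf hfK T hT hTT u hu hpde hbd hin t₀ ht₀ x₀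
  have hTB : (B + 1) * T ≤ 1 / 2 := by
    rw [le_div_iff₀ (by positivity)] at hTT
    linarith
  have hg : ContDiff ℝ l (deriv f) := by
    have := hf
    push_cast at this
    exact (contDiff_succ_iff_deriv.1 this).2.2
  have hg1 : ContDiff ℝ 1 (deriv f) := hg.of_le (by exact_mod_cast hl)
  set U : ℝ := u t₀ x₀ with hU
  set c : ℝ := deriv f U with hc
  have hF : ∀ s ∈ Icc (0:ℝ) T, ∀ x, deriv (fun r => u r x) s
      = -(deriv f (u s x) * deriv (fun y => u s y) x) := by
    intro s hs x
    linarith [hpde s hs x]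
  have htime := VV_time (F := fun s x => -(deriv f (u s x) * deriv (fun y => u s y) x)) hT hu hF
  have hVc : ∀ i ≤ l, ContDiffOn ℝ 1 (VV u i) (Icc (0:ℝ) T ×ˢ (univ : Set ℝ)) :=
    fun i hi => by exact_mod_cast VV_contDiffOn hT hu i 1 (by omega)
  have hline := fun i hi => VV_line (hVc i hi) x₀ t₀ c
  have hV0 : ∀ s x, VV u 0 (s, x) = u s x := fun s x => by simp [VV]
  have hV1 : ∀ s x, VV u 1 (s, x) = deriv (fun y => u s y) x := fun s x => by
    simp [VV, iteratedDeriv_one]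
  -- constancy along the line
  have hconst : ∀ s ∈ Icc (0:ℝ) T, u s (x₀ + c * (s - t₀)) = U := by
    obtain ⟨C0, hC0⟩ := hbd 0 (by omega)
    obtain ⟨C1, hC1⟩ := hbd 1 hl
    simp only [iteratedDeriv_zero] at hC0
    simp only [iteratedDeriv_one] at hC1
    obtain ⟨A, hA⟩ := (isCompact_Icc (a := -C0) (b := C0)).exists_bound_of_continuousOn
      (f := deriv (deriv f)) ((hg1.continuous_deriv (by simp)).continuousOn)
    have hlip : ∀ a ∈ Icc (-C0) C0, ∀ b ∈ Icc (-C0) C0,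
        |deriv f b - deriv f a| ≤ A * |b - a| := fun a ha b hb =>
      Convex.norm_image_sub_le_of_norm_deriv_le (f := deriv f)
        (fun x _ => hg1.differentiable (by simp) x) hA (convex_Icc _ _) ha hb
    have hl0 := hline 0 (by omega)
    have := const_of_deriv_bound (U := U) (L := A * C1) (t₀ := t₀) hl0.1 hl0.2 ?_ ht₀ ?_
    · intro s hs
      rw [← this s hs, hV0]
    · intro s hs
      have hs' := Ioo_subset_Icc_self hs
      rw [htime 0 (by omega) s hs, iteratedDeriv_zero, zero_add, hV1, hV0]
      have e : ∀ a b : ℝ, -(a * b) + c * b = -((a - c) * b) := fun a b => by ring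
      rw [e, abs_neg, abs_mul]
      have h1 := hlip U (abs_le.1 (hC0 t₀ ht₀ x₀)) _ (abs_le.1 (hC0 s hs' (x₀ + c * (s - t₀))))
      have h2 := hC1 s hs' (x₀ + c * (s - t₀))
      calc _ ≤ (A * |u s (x₀ + c * (s - t₀)) - U|) * C1 :=
            mul_le_mul h1 h2 (abs_nonneg _) ((abs_nonneg _).trans h1)
        _ = _ := by ring
    · simp [hV0, hU]
  have hUM : U ∈ Icc (-(M 0)) (M 0) := by
    have h1 := hin 0 (by omega) (x₀ + c * (0 - t₀))
    rw [iteratedDeriv_zero, hconst 0 ⟨le_rfl, hT.le⟩] at h1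
    exact abs_le.1 h1
  -- the vector of derivatives
  set W : ℝ → (Fin (l + 1) → ℝ) := fun s i => VV u i (s, x₀ + c * (s - t₀)) with hW
  set W' : ℝ → (Fin (l + 1) → ℝ) := fun s i =>
    fderiv ℝ (VV u i) (s, x₀ + c * (s - t₀)) (1, 0)
      + c * VV u (i + 1) (s, x₀ + c * (s - t₀)) with hW'
  have hWc : ContinuousOn W (Icc 0 T) :=
    continuousOn_pi.2 fun i => (hline i (by omega)).1
  have hWd : ∀ s ∈ Ioo (0:ℝ) T, HasDerivAt W (W' s) s := fun s hs =>
    hasDerivAt_pi.2 fun i => (hline i (by omega)).2 s hs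
  have hW0 : ‖W 0‖ ≤ S := by
    rw [pi_norm_le_iff_of_nonneg hS0]
    intro i
    exact (hin i (by omega) _).trans (hMS i (by omega))
  have hWb : ∀ s ∈ Ioo (0:ℝ) T, ‖W s‖ ≤ R → ‖W' s‖ ≤ B := by
    intro s hs hWs
    have hs' := Ioo_subset_Icc_self hs
    rw [pi_norm_le_iff_of_nonneg (by linarith)] at hWs
    rw [pi_norm_le_iff_of_nonneg hB0]
    intro i
    have hi : (i : ℕ) ≤ l := by omega
    have hv := slice_contDiff hu hs'
    have hv' : ContDiff ℝ l (fun y => u s y) := hv.of_le (by exact_mod_cast Nat.le_succ l)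
    have hdv : ContDiff ℝ l (deriv (fun y => u s y)) := by
      have := hv
      push_cast at this
      exact (contDiff_succ_iff_deriv.1 this).2.2
    have hE := E_bound (l := l) (g := deriv f) (v := fun y => u s y) (x := x₀ + c * (s - t₀))
      (c := c) hR1 hK hg hv (by simp only [hconst s hs']; rfl)
      (fun j hj => by
        simp only [hconst s hs']
        rw [← iteratedDeriv_succ']
        exact hfK (j + 1) (by omega) (by omega) U hUM) hi
      (fun j hj => hWs ⟨j, by omega⟩)
    have e : W' s i = -iteratedDeriv i
        (fun y => (deriv f (u s y) - c) * deriv (fun y => u s y) y) (x₀ + c * (s - t₀)) := by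
      simp only [hW']
      rw [htime i hi s hs, iteratedDeriv_fun_neg]
      simp only [VV]
      rw [iteratedDeriv_succ']
      have e2 : (fun y => (deriv f (u s y) - c) * deriv (fun y => u s y) y)
          = (fun y => deriv f (u s y) * deriv (fun y => u s y) y)
            - (fun y => c * deriv (fun y => u s y) y) := by
        ext y; simp only [Pi.sub_apply]; ring
      have hi' : ((i : ℕ) : WithTop ℕ∞) ≤ (l : WithTop ℕ∞) := by exact_mod_cast hi
      rw [e2, iteratedDeriv_sub, iteratedDeriv_const_mul_field]
      · ring
      · exact (((hg.comp hv').mul hdv).of_le hi').contDiffAt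
      · exact ((contDiff_const.mul hdv).of_le hi').contDiffAt
    rw [e, norm_neg]
    exact hE
  have hWfin : ‖W t₀‖ ≤ R := by
    rcases ht₀.1.eq_or_lt with h0 | h0
    · rw [← h0]; linarith
    · have hlim : Filter.Tendsto (fun s => ‖W s‖) (nhdsWithin 0 (Ioo 0 t₀)) (nhds ‖W 0‖) :=
        (((hWc 0 ⟨le_rfl, hT.le⟩).norm).mono
          (Ioo_subset_Icc_self.trans (Icc_subset_Icc le_rfl ht₀.2)))
      have hev := hlim.eventually (gt_mem_nhds (show ‖W 0‖ < S + 1 / 2 by linarith))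
      have : (nhdsWithin (0:ℝ) (Ioo 0 t₀)).NeBot := by
        rw [nhdsWithin_Ioo_eq_nhdsGT h0]; infer_instance
      obtain ⟨ε, hε, hεm⟩ := (hev.and self_mem_nhdsWithin).exists
      have hB' : ∀ x : ℝ, HasDerivAt (fun s => S + 1 / 2 + (B + 1) * (s - ε)) (B + 1) x := by
        intro x
        have := (((hasDerivAt_id x).sub_const ε).const_mul (B + 1)).const_add (S + 1 / 2)
        simpa using this
      have hsm : ∀ s ∈ Icc ε t₀, S + 1 / 2 + (B + 1) * (s - ε) ≤ R := by
        intro s hs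
        have h1 : s - ε ≤ T := by linarith [hs.2, ht₀.2, hεm.1]
        have := mul_le_mul_of_nonneg_left h1 (show 0 ≤ B + 1 by linarith)
        linarith
      have hin' : ∀ s ∈ Ico ε t₀, s ∈ Ioo (0:ℝ) T := fun s hs =>
        ⟨hεm.1.trans_le hs.1, hs.2.trans_le ht₀.2⟩
      have := image_norm_le_of_norm_deriv_right_lt_deriv_boundary (f := W) (f' := W')
        (a := ε) (b := t₀) (B := fun s => S + 1 / 2 + (B + 1) * (s - ε)) (B' := fun _ => B + 1)
        (hWc.mono (Icc_subset_Icc hεm.1.le ht₀.2))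
        (fun s hs => (hWd s (hin' s hs)).hasDerivWithinAt)
        (by simpa using hε.le) hB'
        (fun s hs he => by
          have := hWb s (hin' s hs) (he.trans_le (hsm s (Ico_subset_Icc_self hs)))
          linarith)
        (right_mem_Icc.2 hεm.2.le)
      exact this.trans (hsm t₀ (right_mem_Icc.2 hεm.2.le))
  have := (norm_le_pi_norm (W t₀) ⟨l, by omega⟩).trans hWfin
  simpa [hW, VV] using this
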